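/- For every vertex v of a DAG G, the surrounding price and the persistent price satisfy Surround(v) = Pers(v) − 1. -/

import Mathlib

/-! ## Directed graphs and pebbling -/

structure Dgraph where
  V : Type
  [fintypeV : Fintype V]
  [decEqV : DecidableEq V]
  edge : V → V → Prop

attribute [instance] Dgraph.fintypeV Dgraph.decEqV

namespace Dgraph

/-- A directed graph is acyclic if no vertex lies on a directed cycle. -/
def Acyclic (G : Dgraph) : Prop :=
  ∀ v : G.V, ¬ Relation.TransGen G.edge v v

def IsSink (G : Dgraph) (z : G.V) : Prop := ∀ u : G.V, ¬ G.edge z u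

def IsSource (G : Dgraph) (v : G.V) : Prop := ∀ u : G.V, ¬ G.edge u v

def UniqueSink (G : Dgraph) (z : G.V) : Prop :=
  G.IsSink z ∧ ∀ w : G.V, G.IsSink w → w = z

/-- Every vertex has in-degree at most 2. -/
def InDegLe2 (G : Dgraph) : Prop :=
  ∀ v : G.V, {u : G.V | G.edge u v}.ncard ≤ 2

/-- One step of the reversible pebble game. -/
def RevStep (G : Dgraph) (P P' : Finset G.V) : Prop :=
  (∃ v : G.V, v ∉ P ∧ (∀ u : G.V, G.edge u v → u ∈ P) ∧ P' = insert v P) ∨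
  (∃ v : G.V, v ∈ P ∧ (∀ u : G.V, G.edge u v → u ∈ P) ∧ P' = P.erase v)

/-- One step of the standard pebble game. -/
def StdStep (G : Dgraph) (P P' : Finset G.V) : Prop :=
  (∃ v : G.V, v ∉ P ∧ (∀ u : G.V, G.edge u v → u ∈ P) ∧ P' = insert v P) ∨
  (∃ v : G.V, v ∈ P ∧ P' = P.erase v)

/-- An unconditional reversible pebbling of time `τ`. -/
def IsRevPebbling (G : Dgraph) (P : ℕ → Finset G.V) (τ : ℕ) : Prop :=
  P 0 = ∅ ∧ ∀ t < τ, G.RevStep (P t) (P (t+1))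

/-- An unconditional standard pebbling of time `τ`. -/
def IsStdPebbling (G : Dgraph) (P : ℕ → Finset G.V) (τ : ℕ) : Prop :=
  P 0 = ∅ ∧ ∀ t < τ, G.StdStep (P t) (P (t+1))

/-- The space of a pebbling. -/
def space (G : Dgraph) (P : ℕ → Finset G.V) (τ : ℕ) : ℕ :=
  (Finset.range (τ+1)).sup fun t => (P t).card

/-- Persistent (reversible) pebbling price of a vertex. -/
noncomputable def pers (G : Dgraph) (v : G.V) : ℕ :=
  sInf { s : ℕ | ∃ P τ, G.IsRevPebbling P τ ∧ P τ = {v} ∧ G.space P τ = s }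

/-- Visiting (reversible) pebbling price of a vertex. -/
noncomputable def visit (G : Dgraph) (v : G.V) : ℕ :=
  sInf { s : ℕ | ∃ P τ, G.IsRevPebbling P τ ∧ v ∈ P τ ∧ G.space P τ = s }

/-- Surrounding (reversible) pebbling price of a vertex. -/
noncomputable def surround (G : Dgraph) (v : G.V) : ℕ :=
  sInf { s : ℕ | ∃ P τ, G.IsRevPebbling P τ ∧ (∀ u : G.V, G.edge u v → u ∈ P τ) ∧
    G.space P τ = s }

/-- Standard pebbling price of a vertex. -/
noncomputable def black (G : Dgraph) (z : G.V) : ℕ :=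
  sInf { s : ℕ | ∃ P τ, G.IsStdPebbling P τ ∧ P τ = {z} ∧ G.space P τ = s }

/-- Space of a pebbling counted only inside the region `R`. -/
noncomputable def spaceIn (G : Dgraph) (R : Set G.V) (P : ℕ → Finset G.V) (τ : ℕ) : ℕ :=
  (Finset.range (τ+1)).sup fun t => ((P t : Set G.V) ∩ R).ncard

/-- `R`-restricted persistent price. -/
noncomputable def persIn (G : Dgraph) (R : Set G.V) (v : G.V) : ℕ :=
  sInf { s : ℕ | ∃ P τ, G.IsRevPebbling P τ ∧ ((P τ : Set G.V) ∩ R) = {v} ∧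
    G.spaceIn R P τ = s }

/-- `R`-restricted visiting price. -/
noncomputable def visitIn (G : Dgraph) (R : Set G.V) (v : G.V) : ℕ :=
  sInf { s : ℕ | ∃ P τ, G.IsRevPebbling P τ ∧ v ∈ P τ ∧ G.spaceIn R P τ = s }

/-- `R`-restricted surrounding price. -/
noncomputable def surroundIn (G : Dgraph) (R : Set G.V) (v : G.V) : ℕ :=
  sInf { s : ℕ | ∃ P τ, G.IsRevPebbling P τ ∧ (∀ u : G.V, G.edge u v → u ∈ P τ) ∧
    G.spaceIn R P τ = s }

/-- `B` blocks the graph: every directed path from a source to a sink meets `B`. -/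
def Blocks (G : Dgraph) (B : Set G.V) : Prop :=
  ∀ (p : List G.V) (hp : p ≠ []), List.Chain' G.edge p →
    G.IsSource (p.head hp) → G.IsSink (p.getLast hp) → ∃ v ∈ p, v ∈ B

/-- A minimal blocking set. -/
def MinBlocking (G : Dgraph) (B : Set G.V) : Prop :=
  G.Blocks B ∧ ∀ B' : Set G.V, B' ⊂ B → ¬ G.Blocks B'

end Dgraph

namespace Dgraph

/-- One reversible step in which both configurations have at most `s` pebbles. -/
def BStep (G : Dgraph) (s : ℕ) (P Q : Finset G.V) : Prop :=
  G.RevStep P Q ∧ P.card ≤ s ∧ Q.card ≤ s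

/-- Reachability within space `s`. -/
def Rch (G : Dgraph) (s : ℕ) : Finset G.V → Finset G.V → Prop :=
  Relation.ReflTransGen (G.BStep s)

theorem RevStep.symm' {G : Dgraph} {P Q : Finset G.V}
    (hG : G.Acyclic) (h : G.RevStep P Q) : G.RevStep Q P := by
  rcases h with ⟨v, hv, hp, rfl⟩ | ⟨v, hv, hp, rfl⟩
  · right
    refine ⟨v, Finset.mem_insert_self _ _, fun u hu => Finset.mem_insert_of_mem (hp u hu), ?_⟩
    rw [Finset.erase_insert hv]
  · left
    refine ⟨v, Finset.notMem_erase _ _, fun u hu => Finset.mem_erase.2 ⟨?_, hp u hu⟩, ?_⟩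
    · rintro rfl
      exact hG u (Relation.TransGen.single hu)
    · rw [Finset.insert_erase hv]

theorem Rch.symm' {G : Dgraph} {s : ℕ} {P Q : Finset G.V}
    (hG : G.Acyclic) (h : G.Rch s P Q) : G.Rch s Q P := by
  induction h with
  | refl => exact Relation.ReflTransGen.refl
  | tail _ h ih => exact Relation.ReflTransGen.head ⟨h.1.symm' hG, h.2.2, h.2.1⟩ ih

theorem Rch.mono {G : Dgraph} {s r : ℕ} {P Q : Finset G.V}
    (hsr : s ≤ r) (h : G.Rch s P Q) : G.Rch r P Q :=
  Relation.ReflTransGen.mono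
    (fun _ _ h => ⟨h.1, h.2.1.trans hsr, h.2.2.trans hsr⟩ : G.BStep s ≤ G.BStep r) _ _ h

theorem Rch.exists_peb {G : Dgraph} {s : ℕ} {Q : Finset G.V} (h : G.Rch s ∅ Q) :
    ∃ P τ, G.IsRevPebbling P τ ∧ P τ = Q ∧ G.space P τ ≤ s := by
  induction h with
  | refl => exact ⟨fun _ => ∅, 0, ⟨rfl, by simp⟩, rfl, by simp [space]⟩
  | @tail A B _ h ih =>
    obtain ⟨P, τ, ⟨h0, h1⟩, h2, h3⟩ := ih
    refine ⟨fun t => if t ≤ τ then P t else B, τ + 1, ⟨by simpa using h0, ?_⟩, by simp, ?_⟩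
    · intro t ht
      rcases Nat.lt_or_ge t τ with h' | h'
      · have a : t ≤ τ := h'.le
        have b : t + 1 ≤ τ := h'
        simpa only [a, b, if_true] using h1 t h'
      · have a : t = τ := by omega
        subst a
        simpa [h2] using h.1
    · unfold space at *
      rw [Finset.sup_le_iff] at *
      intro t ht
      by_cases a : t ≤ τ
      · simpa [a] using h3 t (by simp; omega)
      · simpa [a] using h.2.2

theorem IsRevPebbling.rch {G : Dgraph} {P : ℕ → Finset G.V} {τ : ℕ}
    (h : G.IsRevPebbling P τ) : G.Rch (G.space P τ) ∅ (P τ) := by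
  have hc : ∀ t ≤ τ, (P t).card ≤ G.space P τ := fun t ht =>
    Finset.le_sup (f := fun t => (P t).card) (by simp; omega)
  have : ∀ t ≤ τ, G.Rch (G.space P τ) ∅ (P t) := by
    intro t
    induction t with
    | zero => intro _; rw [h.1]; exact Relation.ReflTransGen.refl
    | succ n ih =>
      intro hn
      exact Relation.ReflTransGen.tail (ih (by omega))
        ⟨h.2 n (by omega), hc _ (by omega), hc _ hn⟩
  exact this τ le_rfl

theorem rch_pers {G : Dgraph} (hG : G.Acyclic) {v : G.V} {s : ℕ} {Q : Finset G.V}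
    (h : G.Rch s ∅ Q) (hQ : ∀ u, G.edge u v → u ∈ Q) : G.Rch (s + 1) ∅ {v} := by
  have key : (∃ A, v ∉ A ∧ (∀ u, G.edge u v → u ∈ A) ∧ A.card ≤ s ∧ G.Rch s ∅ A ∧
      G.Rch (s + 1) {v} (insert v A)) ∨ (v ∉ Q ∧ Q.card ≤ s ∧ G.Rch s ∅ Q ∧
      G.Rch (s + 1) {v} (insert v Q)) := by
    clear hQ
    induction h with
    | refl =>
      right
      exact ⟨by simp, by simp, Relation.ReflTransGen.refl, Relation.ReflTransGen.refl⟩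
    | @tail A B _ h ih =>
      rcases ih with ih | ⟨h1, h2, h3, h4⟩
      · exact Or.inl ih
      by_cases hA : ∀ u, G.edge u v → u ∈ A
      · exact Or.inl ⟨A, h1, hA, h2, h3, h4⟩
      right
      have hvB : v ∉ B := by
        rcases h.1 with ⟨w, hw, hp, rfl⟩ | ⟨w, hw, hp, rfl⟩
        · have : v ≠ w := by rintro rfl; exact hA hp
          simp [this, h1]
        · simp [h1]
      refine ⟨hvB, h.2.2, Relation.ReflTransGen.tail h3 h, Relation.ReflTransGen.tail h4 ⟨?_, ?_, ?_⟩⟩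
      · rcases h.1 with ⟨w, hw, hp, rfl⟩ | ⟨w, hw, hp, rfl⟩
        · have : w ≠ v := by rintro rfl; exact hA hp
          exact Or.inl ⟨w, by simp [this, hw], fun u hu => Finset.mem_insert_of_mem (hp u hu),
            Finset.insert_comm _ _ _⟩
        · have : v ≠ w := by rintro rfl; exact hA hp
          exact Or.inr ⟨w, by simp [hw], fun u hu => Finset.mem_insert_of_mem (hp u hu),
            (Finset.erase_insert_of_ne this).symm⟩
      · rw [Finset.card_insert_of_notMem h1]; omega
      · rw [Finset.card_insert_of_notMem hvB]; have := h.2.2; omega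
  have : ∃ A, v ∉ A ∧ (∀ u, G.edge u v → u ∈ A) ∧ A.card ≤ s ∧ G.Rch s ∅ A ∧
      G.Rch (s + 1) {v} (insert v A) := by
    rcases key with k | ⟨h1, h2, h3, h4⟩
    · exact k
    · exact ⟨Q, h1, hQ, h2, h3, h4⟩
  obtain ⟨A, h1, h2, h3, h4, h5⟩ := this
  refine Relation.ReflTransGen.trans (Relation.ReflTransGen.tail (h4.mono (Nat.le_succ s)) ?_)
    (h5.symm' hG)
  refine ⟨Or.inl ⟨v, h1, h2, rfl⟩, by omega, ?_⟩
  rw [Finset.card_insert_of_notMem h1]; omega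

open Classical in
theorem rch_surround {G : Dgraph} (hG : G.Acyclic) {v : G.V} {s : ℕ}
    (h : G.Rch (s + 1) ∅ {v}) : ∃ Q, G.Rch s ∅ Q ∧ ∀ u, G.edge u v → u ∈ Q := by
  let N : G.V → Prop := fun u => ¬ Relation.ReflTransGen G.edge v u
  have hNv : ¬ N v := fun h => h Relation.ReflTransGen.refl
  have hNp : ∀ u w, G.edge u w → N w → N u := fun u w e hw hu => hw (hu.tail e)
  have hNe : ∀ u, G.edge u v → N u := fun u e hu =>
    hG v (Relation.TransGen.tail' hu e)
  have hcard : ∀ A : Finset G.V, v ∈ A → A.card ≤ s + 1 → (A.filter N).card ≤ s := by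
    intro A hv hA
    have : A.filter N ⊆ A.erase v := by
      intro x hx
      rw [Finset.mem_filter] at hx
      refine Finset.mem_erase.2 ⟨?_, hx.1⟩
      rintro rfl
      exact hNv hx.2
    have := Finset.card_le_card this
    rw [Finset.card_erase_of_mem hv] at this
    omega
  have key : ∀ A, G.Rch (s + 1) A {v} → (∃ Q, G.Rch s ∅ Q ∧ ∀ u, G.edge u v → u ∈ Q) ∨
      (v ∈ A ∧ G.Rch s ∅ (A.filter N)) := by
    intro A hA
    induction hA using Relation.ReflTransGen.head_induction_on with
    | refl =>
      right
      refine ⟨by simp, ?_⟩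
      rw [Finset.filter_singleton, if_neg hNv]
      exact Relation.ReflTransGen.refl
    | @head A B h _ ih =>
      rcases ih with ih | ⟨hv, hr⟩
      · exact Or.inl ih
      by_cases hvA : v ∈ A
      · right
        refine ⟨hvA, ?_⟩
        have c1 := hcard A hvA h.2.1
        have c2 := hcard B hv h.2.2
        rcases h.1 with ⟨w, hw, hp, rfl⟩ | ⟨w, hw, hp, rfl⟩
        · by_cases hN : N w
          · refine Relation.ReflTransGen.tail hr ⟨RevStep.symm' hG (Or.inl ⟨w, ?_, ?_, ?_⟩), c2, c1⟩
            · simp [hw]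
            · exact fun u hu => Finset.mem_filter.2 ⟨hp u hu, hNp u w hu hN⟩
            · rw [Finset.filter_insert, if_pos hN]
          · rwa [Finset.filter_insert, if_neg hN] at hr
        · by_cases hN : N w
          · refine Relation.ReflTransGen.tail hr ⟨RevStep.symm' hG (Or.inr ⟨w, ?_, ?_, ?_⟩), c2, c1⟩
            · simp [hw, hN]
            · exact fun u hu => Finset.mem_filter.2 ⟨hp u hu, hNp u w hu hN⟩
            · rw [Finset.filter_erase]
          · rw [Finset.filter_erase, Finset.erase_eq_of_notMem (by simp [hN])] at hr
            exact hr
      · left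
        refine ⟨_, hr, fun u hu => Finset.mem_filter.2 ⟨?_, hNe u hu⟩⟩
        rcases h.1 with ⟨w, hw, hp, rfl⟩ | ⟨w, hw, hp, rfl⟩
        · rcases Finset.mem_insert.1 hv with rfl | h'
          · exact Finset.mem_insert_of_mem (hp u hu)
          · exact absurd h' hvA
        · exact absurd (Finset.mem_of_mem_erase hv) hvA
  rcases key ∅ h with k | ⟨k, _⟩
  · exact k
  · simp at k

theorem rch_univ {G : Dgraph} (hG : G.Acyclic) :
    G.Rch (Fintype.card G.V) ∅ Finset.univ := by
  have wf : WellFounded (Relation.TransGen G.edge) := by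
    haveI : Std.Irrefl (Relation.TransGen G.edge) := ⟨hG⟩
    exact Finite.wellFounded_of_trans_of_irrefl _
  have key : ∀ n ≤ Fintype.card G.V, ∃ A : Finset G.V, A.card = n ∧
      G.Rch (Fintype.card G.V) ∅ A := by
    intro n
    induction n with
    | zero => exact fun _ => ⟨∅, rfl, Relation.ReflTransGen.refl⟩
    | succ n ih =>
      intro hn
      obtain ⟨A, hA, hr⟩ := ih (by omega)
      have hne : ({x | x ∉ A} : Set G.V).Nonempty := by
        by_contra hc
        rw [Set.not_nonempty_iff_eq_empty, Set.eq_empty_iff_forall_notMem] at hc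
        have : A = Finset.univ := Finset.eq_univ_iff_forall.2 fun x => by simpa using hc x
        rw [this, Finset.card_univ] at hA
        omega
      obtain ⟨m, hm, hmin⟩ := wf.has_min _ hne
      refine ⟨insert m A, by rw [Finset.card_insert_of_notMem hm, hA], hr.tail
        ⟨Or.inl ⟨m, hm, fun u hu => ?_, rfl⟩, Finset.card_le_univ _, Finset.card_le_univ _⟩⟩
      by_contra hc
      exact hmin u hc (Relation.TransGen.single hu)
  obtain ⟨A, hA, hr⟩ := key _ le_rfl
  rwa [(Finset.card_eq_iff_eq_univ A).1 hA] at hr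

theorem pers_le_of_rch {G : Dgraph} {v : G.V} {s : ℕ} (h : G.Rch s ∅ {v}) : G.pers v ≤ s := by
  obtain ⟨P, τ, h1, h2, h3⟩ := h.exists_peb
  refine le_trans (Nat.sInf_le ?_) h3
  exact ⟨P, τ, h1, h2, rfl⟩

theorem surround_le_of_rch {G : Dgraph} {v : G.V} {s : ℕ} {Q : Finset G.V} (h : G.Rch s ∅ Q)
    (hQ : ∀ u, G.edge u v → u ∈ Q) : G.surround v ≤ s := by
  obtain ⟨P, τ, h1, h2, h3⟩ := h.exists_peb
  refine le_trans (Nat.sInf_le ?_) h3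
  exact ⟨P, τ, h1, by rwa [h2], rfl⟩

theorem rch_surround_price {G : Dgraph} (hG : G.Acyclic) (v : G.V) :
    ∃ Q, G.Rch (G.surround v) ∅ Q ∧ ∀ u, G.edge u v → u ∈ Q := by
  obtain ⟨P, τ, h1, h2, _⟩ := (rch_univ hG).exists_peb
  have hm := Nat.sInf_mem (s := { s : ℕ | ∃ P τ, G.IsRevPebbling P τ ∧
    (∀ u : G.V, G.edge u v → u ∈ P τ) ∧ G.space P τ = s }) ⟨_, P, τ, h1, by simp [h2], rfl⟩
  obtain ⟨P, τ, h1, h2, h3⟩ := hm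
  refine ⟨P τ, ?_, h2⟩
  have := h1.rch
  rw [h3] at this
  exact this

theorem rch_pers_price {G : Dgraph} (hG : G.Acyclic) (v : G.V) :
    G.Rch (G.pers v) ∅ {v} := by
  obtain ⟨Q, hQ, hQ'⟩ := rch_surround_price hG v
  obtain ⟨P, τ, h1, h2, _⟩ := (rch_pers hG hQ hQ').exists_peb
  have hm := Nat.sInf_mem (s := { s : ℕ | ∃ P τ, G.IsRevPebbling P τ ∧
    P τ = {v} ∧ G.space P τ = s }) ⟨_, P, τ, h1, h2, rfl⟩
  obtain ⟨P, τ, h1, h2, h3⟩ := hm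
  have := h1.rch
  rw [h3, h2] at this
  exact this

theorem pers_pos {G : Dgraph} (hG : G.Acyclic) (v : G.V) : 0 < G.pers v := by
  rcases Relation.ReflTransGen.cases_tail (rch_pers_price hG v) with h | ⟨_, _, h⟩
  · simp at h
  · have := h.2.2
    simp at this
    omega

end Dgraph

/-- The surrounding price is one less than the persistent price
(Proposition `lem:surrounding-eq-persistent`). -/
theorem surrounding_eq_persistent (G : Dgraph) (hG : G.Acyclic) (v : G.V) :
    G.surround v = G.pers v - 1 ∧ G.surround v + 1 = G.pers v := by
  have h1 : G.pers v ≤ G.surround v + 1 := by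
    obtain ⟨Q, hQ, hQ'⟩ := Dgraph.rch_surround_price hG v
    exact Dgraph.pers_le_of_rch (Dgraph.rch_pers hG hQ hQ')
  have h0 := Dgraph.pers_pos hG v
  have h2 : G.surround v ≤ G.pers v - 1 := by
    have h := Dgraph.rch_pers_price hG v
    rw [← Nat.sub_add_cancel h0] at h
    obtain ⟨Q, hQ, hQ'⟩ := Dgraph.rch_surround hG h
    exact Dgraph.surround_le_of_rch hQ hQ'
  omega
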